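/- arXiv:2510.08341 — 9 statements merged into one kernel-verified Lean document; each statement's English description precedes it below -/
import Mathlib

section
/- Let n be a positive integer and let u, v, w ∈ ℝⁿ be vectors such that wᵢ < 0 for every index 1 ≤ i ≤ n. Then the matrix A := 𝟙uᵀ + v𝟙ᵀ + diag(w) ∈ ℝ^{n×n} has rank at least n − 1, where 𝟙 ∈ ℝⁿ denotes the all-ones vector and diag(w) the diagonal matrix with diagonal entries w₁,…,wₙ. -/
/-- Let `n` be a positive integer and `u, v, w ∈ ℝⁿ` with `wᵢ < 0` for all `i`.
Then `A := 𝟙uᵀ + v𝟙ᵀ + diag(w)` has rank at least `n − 1`. -/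
theorem rank_ge_of_neg_diag (n : ℕ) (hn : 0 < n) (u v w : Fin n → ℝ)
    (hw : ∀ i, w i < 0) :
    n - 1 ≤ (Matrix.vecMulVec (1 : Fin n → ℝ) u + Matrix.vecMulVec v (1 : Fin n → ℝ) +
      Matrix.diagonal w).rank := by
  set A := Matrix.vecMulVec (1 : Fin n → ℝ) u + Matrix.vecMulVec v (1 : Fin n → ℝ) +
      Matrix.diagonal w with hA
  have hrn := LinearMap.finrank_range_add_finrank_ker A.mulVecLin
  rw [Module.finrank_fin_fun] at hrn
  change A.rank + _ = n at hrn
  let f : (Fin n → ℝ) →ₗ[ℝ] ℝ := ∑ i, LinearMap.proj i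
  have hf : ∀ x, f x = ∑ i, x i := fun x => by simp [f]
  have hinj : Function.Injective (f.comp (LinearMap.ker A.mulVecLin).subtype) := by
    rw [← LinearMap.ker_eq_bot, LinearMap.ker_eq_bot']
    rintro ⟨x, hx⟩ h0
    have hs : ∑ i, x i = 0 := by simpa [hf] using h0
    have hAx : ∀ i, (∑ j, u j * x j) + w i * x i = 0 := by
      intro i
      have h1 : (A.mulVec x) i = 0 := by
        have := LinearMap.mem_ker.mp hx
        rw [Matrix.mulVecLin_apply] at this
        rw [this]; rfl
      rw [hA, Matrix.add_mulVec, Matrix.add_mulVec, Pi.add_apply, Pi.add_apply,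
        Matrix.mulVec_diagonal] at h1
      simp only [Matrix.mulVec, dotProduct, Matrix.vecMulVec_apply, Pi.one_apply, one_mul,
        mul_one, ← Finset.mul_sum, hs, mul_zero, add_zero] at h1
      exact h1
    set c := ∑ j, u j * x j
    have hxi : ∀ i, x i = c * (-(w i)⁻¹) := by
      intro i
      have := hAx i
      have := (hw i).ne
      field_simp
      linarith
    have hpos : 0 < ∑ i, (-(w i)⁻¹) :=
      Finset.sum_pos (fun i _ => by simpa using hw i) ⟨⟨0, hn⟩, Finset.mem_univ _⟩
    have hc : c = 0 := by
      rw [Finset.sum_congr rfl (fun i _ => hxi i), ← Finset.mul_sum] at hs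
      exact (mul_eq_zero.mp hs).resolve_right hpos.ne'
    ext i
    simp [hxi i, hc]
  have h := LinearMap.finrank_le_finrank_of_injective hinj
  rw [Module.finrank_self] at h
  omega
end

section
/- Let n be a positive integer and let u, v, w ∈ ℝⁿ with wᵢ < 0 for every index 1 ≤ i ≤ n, and set A := 𝟙uᵀ + v𝟙ᵀ + diag(w) ∈ ℝ^{n×n}. Then A is injective on the subspace Z = {x ∈ ℝⁿ : Σ_{i=1}^n xᵢ = 0}; that is, if x ∈ ℝⁿ satisfies Σ_{i=1}^n xᵢ = 0 and Ax = 0, then x = 0. -/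
/-- Let `n` be a positive integer and `u, v, w ∈ ℝⁿ` with `wᵢ < 0` for all `i`, and
`A := 𝟙uᵀ + v𝟙ᵀ + diag(w)`. If `x ∈ ℝⁿ` satisfies `∑ᵢ xᵢ = 0` and `Ax = 0`, then `x = 0`. -/
theorem injective_on_zero_sum_subspace (n : ℕ) (hn : 0 < n) (u v w : Fin n → ℝ)
    (hw : ∀ i, w i < 0) (x : Fin n → ℝ) (hx : ∑ i, x i = 0)
    (hAx : (Matrix.vecMulVec (1 : Fin n → ℝ) u + Matrix.vecMulVec v (1 : Fin n → ℝ) +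
      Matrix.diagonal w).mulVec x = 0) :
    x = 0 := by
  have h : ∀ i, (∑ j, u j * x j) + w i * x i = 0 := by
    intro i
    have h1 := congrFun hAx i
    rw [Matrix.add_mulVec, Matrix.add_mulVec, Pi.add_apply, Pi.add_apply,
      Matrix.mulVec_diagonal] at h1
    have h2 : (Matrix.vecMulVec (1 : Fin n → ℝ) u).mulVec x i = ∑ j, u j * x j := by
      simp [Matrix.mulVec, dotProduct, Matrix.vecMulVec_apply]
    have h3 : (Matrix.vecMulVec v (1 : Fin n → ℝ)).mulVec x i = 0 := by
      simp [Matrix.mulVec, dotProduct, Matrix.vecMulVec_apply, ← Finset.mul_sum, hx]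
    rw [h2, h3] at h1
    simpa using h1
  have hs : ∑ i, (-w i) * x i ^ 2 = 0 := by
    have e : ∀ i, (-w i) * x i ^ 2 = (∑ j, u j * x j) * x i := by
      intro i
      linear_combination (-x i) * h i
    simp_rw [e]
    rw [← Finset.mul_sum, hx, mul_zero]
  have hz := (Finset.sum_eq_zero_iff_of_nonneg (fun i _ =>
    mul_nonneg (neg_nonneg.2 (hw i).le) (sq_nonneg (x i)))).1 hs
  funext i
  have := hz i (Finset.mem_univ i)
  simpa [(hw i).ne] using this
end

section
/- Let v ≥ 2, let B, D ∈ ℝ^{v×v}, and let f be the constant-attention model defined by B and D. If there exists C > 0 such that f has precision C at length 1, then the matrix B + D has rank at least v − 1. -/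
/-- The constant-attention model defined by matrices `B` and `D`: on an input
sequence `t = (t₀, …, tₙ)` of length `n + 1`, the output logit vector is
`f(t) = B_{tₙ,:} + (1/(n+1)) · ∑ᵢ D_{tᵢ,:}`. -/
noncomputable def cam {v : ℕ} (B D : Matrix (Fin v) (Fin v) ℝ) {n : ℕ}
    (t : Fin (n + 1) → Fin v) : Fin v → ℝ :=
  fun j => B (t (Fin.last n)) j + ((n + 1 : ℕ) : ℝ)⁻¹ * ∑ i, D (t i) j

/-- The model has precision `C` at length `s`: for every valid input sequence `t`
(pairwise distinct entries) of length `s`, every `u ∉ [t]` and every `w`,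
`f(t)_u − f(t)_w > C` if `w ∈ [t]`, and `f(t)_u − f(t)_w = 0` if `w ∉ [t]`. -/
def hasPrec {v : ℕ} (B D : Matrix (Fin v) (Fin v) ℝ) (C : ℝ) (s : ℕ) : Prop :=
  ∀ n : ℕ, n + 1 = s → ∀ t : Fin (n + 1) → Fin v, Function.Injective t →
    ∀ u : Fin v, u ∉ Set.range t → ∀ w : Fin v,
      (w ∈ Set.range t → cam B D t u - cam B D t w > C) ∧
      (w ∉ Set.range t → cam B D t u - cam B D t w = 0)

/-- If the constant-attention model defined by `B` and `D` has precision `C > 0`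
at length 1, then `B + D` has rank at least `v − 1`. -/
theorem rank_B_add_D_ge (v : ℕ) (hv : 2 ≤ v) (B D : Matrix (Fin v) (Fin v) ℝ)
    (C : ℝ) (hC : 0 < C) (h1 : hasPrec B D C 1) :
    v - 1 ≤ (B + D).rank := by
  have key : ∀ i u : Fin v, u ≠ i → ∀ w : Fin v,
      (w = i → (B + D) i u - (B + D) i w > C) ∧ (w ≠ i → (B + D) i u - (B + D) i w = 0) := by
    intro i u hu w
    have h := h1 0 rfl (fun _ => i) (fun a b _ => Fin.ext (by omega)) u
      (by rintro ⟨_, h⟩; exact hu h.symm) w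
    simp only [cam, Set.mem_range, exists_const] at h
    simp only [Matrix.add_apply]
    refine ⟨fun hw => ?_, fun hw => ?_⟩
    · simpa using h.1 hw.symm
    · simpa using h.2 (fun e => hw e.symm)
  have : Nontrivial (Fin v) := Fin.nontrivial_iff_two_le.mpr hv
  choose o ho using fun i : Fin v => exists_ne i
  have hd : Matrix.diagonal (fun i => (B + D) i i - (B + D) i (o i))
      = (B + D) + Matrix.vecMulVec (fun i => -(B + D) i (o i)) (fun _ => 1) := by
    ext i j
    rw [Matrix.add_apply (B + D), Matrix.vecMulVec_apply]
    by_cases hij : j = i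
    · subst hij
      rw [Matrix.diagonal_apply_eq]; ring
    · rw [Matrix.diagonal_apply_ne _ (Ne.symm hij)]
      have := (key i (o i) (ho i) j).2 hij
      linarith
  have hr : (Matrix.diagonal (fun i => (B + D) i i - (B + D) i (o i))).rank = v := by
    rw [Matrix.rank_of_isUnit, Fintype.card_fin]
    rw [Matrix.isUnit_iff_isUnit_det, Matrix.det_diagonal, isUnit_iff_ne_zero,
      Finset.prod_ne_zero_iff]
    intro i _
    have := (key i (o i) (ho i) i).1 rfl
    intro h; linarith
  have radd : ∀ M N : Matrix (Fin v) (Fin v) ℝ, (M + N).rank ≤ M.rank + N.rank := by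
    intro M N
    unfold Matrix.rank
    rw [Matrix.mulVecLin_add]
    exact (Submodule.finrank_mono (LinearMap.range_add_le _ _)).trans
      (Submodule.finrank_add_le_finrank_add_finrank _ _)
  have h2 := radd (B + D)
    (Matrix.vecMulVec (fun i => -(B + D) i (o i)) (fun _ => (1 : ℝ)))
  have h3 := Matrix.rank_vecMulVec_le (fun i => -(B + D) i (o i)) (fun _ : Fin v => (1 : ℝ))
  rw [← hd, hr] at h2
  omega
end

section
/- Let v ≥ 2, let B, D ∈ ℝ^{v×v}, and let f be the constant-attention model defined by B and D. Suppose there exists C > 0 such that f has precision C at length 1, and suppose B + D factors as B + D = P·U for some matrices P ∈ ℝ^{v×d} and U ∈ ℝ^{d×v}. Then d ≥ v − 1. -/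
/-- If the constant-attention model defined by `B` and `D` has precision `C > 0`
at length 1, and `B + D = P · U` with `P ∈ ℝ^{v×d}`, `U ∈ ℝ^{d×v}`, then `d ≥ v − 1`. -/
theorem embedding_dim_ge (v : ℕ) (hv : 2 ≤ v) (B D : Matrix (Fin v) (Fin v) ℝ)
    (C : ℝ) (hC : 0 < C) (h1 : hasPrec B D C 1)
    (d : ℕ) (P : Matrix (Fin v) (Fin d) ℝ) (U : Matrix (Fin d) (Fin v) ℝ)
    (hfact : B + D = P * U) :
    v - 1 ≤ d := by
  have key : ∀ t : Fin v, ∃ m e : ℝ, e ≠ 0 ∧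
      ∀ j, (B + D) t j = m - e * (if j = t then 1 else 0) := by
    intro t
    have : Nontrivial (Fin v) := Fin.nontrivial_iff_two_le.mpr hv
    obtain ⟨u, hu⟩ := exists_ne t
    have hc : ∀ j, cam B D (n := 0) (fun _ => t) j = (B + D) t j := by
      intro j
      simp [cam]
    have h := h1 0 rfl (fun _ => t) (fun a b _ => Subsingleton.elim (α := Fin 1) a b) u
      (by simpa using hu)
    simp only [hc] at h
    have ht := (h t).1 (by simp)
    refine ⟨(B + D) t u, (B + D) t u - (B + D) t t, (by linarith : (0:ℝ) < _).ne', ?_⟩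
    intro j
    by_cases hj : j = t
    · subst hj
      simp
    · have := (h j).2 (by simpa using hj)
      rw [if_neg hj]
      linarith
  let L : (Fin v → ℝ) →ₗ[ℝ] (Fin d → ℝ) × ℝ :=
    (Matrix.mulVecLin U).prod (∑ i, LinearMap.proj i)
  have hL : Function.Injective L := by
    rw [injective_iff_map_eq_zero]
    intro x hx
    have hx1 : U.mulVec x = 0 := congrArg Prod.fst hx
    have hx2 : ∑ i, x i = 0 := by
      have := congrArg Prod.snd hx
      simpa [L] using this
    have hM : (B + D).mulVec x = 0 := by
      rw [hfact, ← Matrix.mulVec_mulVec, hx1, Matrix.mulVec_zero]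
    funext t
    obtain ⟨m, e, he, h⟩ := key t
    have h2 : ∑ j, (B + D) t j * x j = 0 := congrFun hM t
    simp only [h, sub_mul, Finset.sum_sub_distrib, ← Finset.mul_sum, hx2] at h2
    simpa [he] using h2
  have := LinearMap.finrank_le_finrank_of_injective hL
  simp at this
  omega
end

section
/- Let v ≥ 3, let B, D ∈ ℝ^{v×v}, and let f be the constant-attention model defined by B and D. If there exists C > 0 such that f has precision C at length 1 and precision C at length 2, then the matrix D has rank at least v − 1. -/
theorem prec_one {v : ℕ} {B D : Matrix (Fin v) (Fin v) ℝ} {C : ℝ} (h1 : hasPrec B D C 1)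
    (a u : Fin v) (hu : u ≠ a) :
    (B a u + D a u) - (B a a + D a a) > C ∧
    ∀ w, w ≠ a → (B a u + D a u) - (B a w + D a w) = 0 := by
  have h := h1 0 rfl ![a] (fun i j _ => Fin.ext (by omega)) u (by simpa using hu)
  refine ⟨?_, fun w hw => ?_⟩
  · have := (h a).1 (by simp)
    simpa [cam] using this
  · have := (h w).2 (by simpa using hw)
    simpa [cam] using this

theorem prec_two {v : ℕ} {B D : Matrix (Fin v) (Fin v) ℝ} {C : ℝ} (h2 : hasPrec B D C 2)
    (a b u : Fin v) (hab : a ≠ b) (hua : u ≠ a) (hub : u ≠ b) :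
    (B b u + (D a u + D b u) / 2) - (B b a + (D a a + D b a) / 2) > C ∧
    ∀ w, w ≠ a → w ≠ b →
      (B b u + (D a u + D b u) / 2) - (B b w + (D a w + D b w) / 2) = 0 := by
  have hinj : Function.Injective ![a, b] := by
    intro i j hij
    fin_cases i <;> fin_cases j <;> simp_all
  have h := h2 1 rfl ![a, b] hinj u (by simp [hua, hub])
  have hc : ∀ j, cam B D ![a, b] j = B b j + (D a j + D b j) / 2 := by
    intro j
    simp only [cam]
    simp [Fin.last]
    ring
  refine ⟨?_, fun w hwa hwb => ?_⟩
  · have := (h a).1 (by simp)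
    simpa only [hc] using this
  · have := (h w).2 (by simp [hwa, hwb])
    simpa only [hc] using this

theorem key_pair {v : ℕ} (hv : 3 ≤ v) {B D : Matrix (Fin v) (Fin v) ℝ} {C : ℝ} (hC : 0 < C)
    (h1 : hasPrec B D C 1) (h2 : hasPrec B D C 2) (x : Fin v → ℝ)
    (hx : D.mulVec x = 0) (hs : ∑ i, x i = 0) (a b : Fin v) (hab : a ≠ b) :
    ∃ q q' : ℝ, 0 < q ∧ 0 < q' ∧ q * x a = q' * x b := by
  obtain ⟨u, hu⟩ : ∃ u, u ∉ ({a, b} : Finset (Fin v)) := by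
    by_contra! hcon
    have h3 := Finset.card_le_card (fun z _ => hcon z : (Finset.univ : Finset (Fin v)) ⊆ {a, b})
    have h4 := Finset.card_le_two (a := a) (b := b)
    simp only [Finset.card_univ, Fintype.card_fin] at h3
    omega
  simp only [Finset.mem_insert, Finset.mem_singleton, not_or] at hu
  obtain ⟨hua, hub⟩ := hu
  have p1 := prec_two h2 a b u hab hua hub
  have p2 := prec_two h2 b a u hab.symm hub hua
  have o1 := prec_one h1 b u hub
  have o2 := prec_one h1 a u hua
  have o1a := o1.2 a hab
  have o2b := o2.2 b hab.symm
  refine ⟨(D a u - D b u) - (D a a - D b a), (D a b - D b b) - (D a u - D b u), ?_, ?_, ?_⟩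
  · linarith [p1.1]
  · linarith [p2.1]
  · have ha : ∑ w, D a w * x w = 0 := congrFun hx a
    have hb : ∑ w, D b w * x w = 0 := congrFun hx b
    have hd : ∀ w, D a w * x w - D b w * x w = (D a u - D b u) * x w
        - (if w = a then ((D a u - D b u) - (D a a - D b a)) * x w else 0)
        + (if w = b then ((D a b - D b b) - (D a u - D b u)) * x w else 0) := by
      intro w
      by_cases hwa : w = a
      · subst hwa
        simp [hab]
        ring
      · by_cases hwb : w = b
        · subst hwb
          simp [hwa]
          ring
        · have e1 := p1.2 w hwa hwb
          have e2 := o1.2 w hwb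
          have e3 : D a w - D b w = D a u - D b u := by linarith
          simp [hwa, hwb]
          rw [← e3]
          ring
    have hsum := Finset.sum_congr (rfl : (Finset.univ : Finset (Fin v)) = _) (fun w _ => hd w)
    rw [Finset.sum_sub_distrib, ha, hb, Finset.sum_add_distrib, Finset.sum_sub_distrib,
      ← Finset.mul_sum, hs] at hsum
    simp only [Finset.sum_ite_eq', Finset.mem_univ, if_true] at hsum
    linarith

theorem ker_zero {v : ℕ} (hv : 3 ≤ v) {B D : Matrix (Fin v) (Fin v) ℝ} {C : ℝ} (hC : 0 < C)
    (h1 : hasPrec B D C 1) (h2 : hasPrec B D C 2) (x : Fin v → ℝ)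
    (hx : D.mulVec x = 0) (hs : ∑ i, x i = 0) : x = 0 := by
  funext a
  have hnn : ∀ b ∈ (Finset.univ : Finset (Fin v)), 0 ≤ x a * x b := by
    intro b _
    by_cases hab : a = b
    · subst hab
      exact mul_self_nonneg _
    · obtain ⟨q, q', hq, hq', h⟩ := key_pair hv hC h1 h2 x hx hs a b hab
      have h5 : q' * (x a * x b) = q * (x a * x a) := by linear_combination -(x a) * h
      have h6 : 0 ≤ q' * (x a * x b) := by
        rw [h5]
        exact mul_nonneg hq.le (mul_self_nonneg _)
      exact nonneg_of_mul_nonneg_right h6 hq'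
  have h0 : ∑ b, x a * x b = 0 := by rw [← Finset.mul_sum, hs, mul_zero]
  have := (Finset.sum_eq_zero_iff_of_nonneg hnn).1 h0 a (Finset.mem_univ a)
  exact mul_self_eq_zero.1 this

/-- If the constant-attention model defined by `B` and `D` has precision `C > 0`
at lengths 1 and 2, then `D` has rank at least `v − 1`. -/
theorem rank_D_ge (v : ℕ) (hv : 3 ≤ v) (B D : Matrix (Fin v) (Fin v) ℝ)
    (C : ℝ) (hC : 0 < C) (h1 : hasPrec B D C 1) (h2 : hasPrec B D C 2) :
    v - 1 ≤ D.rank := by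
  let S : (Fin v → ℝ) →ₗ[ℝ] ℝ := ∑ i, LinearMap.proj i
  let L := D.mulVecLin.rangeRestrict.prod S
  have hL : Function.Injective L := by
    rw [← LinearMap.ker_eq_bot, LinearMap.ker_eq_bot']
    intro x hx
    have e1 : D.mulVec x = 0 := congrArg Subtype.val (congrArg Prod.fst hx)
    have e2 : S x = 0 := congrArg Prod.snd hx
    refine ker_zero hv hC h1 h2 x e1 ?_
    simpa [S] using e2
  have := LinearMap.finrank_le_finrank_of_injective hL
  rw [Module.finrank_prod, Module.finrank_self, Module.finrank_fin_fun] at this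
  unfold Matrix.rank
  omega
end

section
/- Let v ≥ 3, let B, D ∈ ℝ^{v×v}, and let f be the constant-attention model defined by B and D. Suppose there exists C > 0 such that f has precision C at length 1 and precision C at length 2, and suppose D factors as D = M·N for some matrices M ∈ ℝ^{v×d_v} and N ∈ ℝ^{d_v×v}. Then d_v ≥ v − 1. -/
/-- If the constant-attention model defined by `B` and `D` has precision `C > 0`
at lengths 1 and 2, and `D = M · N` with `M ∈ ℝ^{v×d_v}`, `N ∈ ℝ^{d_v×v}`, then `d_v ≥ v − 1`. -/
theorem value_dim_ge (v : ℕ) (hv : 3 ≤ v) (B D : Matrix (Fin v) (Fin v) ℝ)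
    (C : ℝ) (hC : 0 < C) (h1 : hasPrec B D C 1) (h2 : hasPrec B D C 2)
    (dv : ℕ) (M : Matrix (Fin v) (Fin dv) ℝ) (N : Matrix (Fin dv) (Fin v) ℝ)
    (hfact : D = M * N) :
    v - 1 ≤ dv := by
  by_contra hlt
  have hlt : dv + 1 < v := by omega
  -- lengths 1 and 2 unpacked
  have E0 : ∀ a u w : Fin v, u ≠ a → w ≠ a → B a u + D a u = B a w + D a w := by
    intro a u w hu hw
    have := (h1 0 rfl ![a] (fun i j _ => Fin.ext (by omega)) u (by simpa using hu) w).2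
      (by simpa using hw)
    simp [cam] at this
    linarith
  have inj : ∀ a b : Fin v, a ≠ b → Function.Injective ![a, b] := by
    intro a b hab i j hij
    fin_cases i <;> fin_cases j <;> simp_all
  have F0 : ∀ a b u w : Fin v, a ≠ b → u ≠ a → u ≠ b → w ≠ a → w ≠ b →
      D a u - D b u = D a w - D b w := by
    intro a b u w hab hua hub hwa hwb
    have := (h2 1 rfl ![a, b] (inj a b hab) u (by simp [hua, hub]) w).2
      (by simp [hwa, hwb])
    have e := E0 b u w hub hwb
    simp [cam, Fin.sum_univ_two] at this
    linarith
  have F1 : ∀ a b u : Fin v, a ≠ b → u ≠ a → u ≠ b →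
      0 < (D a u - D b u) - (D a a - D b a) := by
    intro a b u hab hua hub
    have := (h2 1 rfl ![a, b] (inj a b hab) u (by simp [hua, hub]) a).1
      ⟨0, by simp⟩
    have e := E0 b u a hub hab
    simp [cam, Fin.sum_univ_two] at this
    linarith
  let c : Fin v := ⟨0, by omega⟩
  have key : ∀ a : Fin v, ∃ k p q : ℝ, (∀ j, D a j - D c j =
      k - (if j = a then p else 0) + (if j = c then q else 0)) ∧
      (a ≠ c → 0 < p ∧ 0 < q) ∧ (a = c → p = 0 ∧ q = 0) := by
    intro a
    by_cases hac : a = c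
    · exact ⟨0, 0, 0, by simp [hac], fun h => absurd hac h, fun _ => ⟨rfl, rfl⟩⟩
    · obtain ⟨u, hu⟩ : ∃ u : Fin v, u ∉ ({a, c} : Finset (Fin v)) := by
        by_contra! h
        have h3 := Finset.card_le_card (fun x _ => h x : (Finset.univ : Finset (Fin v)) ⊆ {a, c})
        have h4 := Finset.card_le_two (a := a) (b := c)
        simp only [Finset.card_univ, Fintype.card_fin] at h3
        omega
      simp only [Finset.mem_insert, Finset.mem_singleton, not_or] at hu
      obtain ⟨hua, huc⟩ := hu
      refine ⟨D a u - D c u, (D a u - D c u) - (D a a - D c a),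
        (D a c - D c c) - (D a u - D c u), ?_, ?_, fun h => absurd h hac⟩
      · intro j
        by_cases hja : j = a
        · subst hja
          simp [hac]
        · by_cases hjc : j = c
          · rw [if_neg hja, if_pos hjc, hjc]; ring
          · rw [if_neg hja, if_neg hjc, F0 a c u j hac hua huc hja hjc]; ring
      · intro _
        refine ⟨F1 a c u hac hua huc, ?_⟩
        have := F1 c a u (Ne.symm hac) huc hua
        linarith
  choose k p q hD hpos hzero using key
  -- a nonzero kernel vector
  let L : (Fin v → ℝ) →ₗ[ℝ] ((Fin dv → ℝ) × ℝ) :=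
    (Matrix.vecMulLinear M).prod (∑ i, LinearMap.proj i)
  have hL : LinearMap.ker L ≠ ⊥ := by
    apply LinearMap.ker_ne_bot_of_finrank_lt
    simpa using hlt
  obtain ⟨x, hx, hx0⟩ := (Submodule.ne_bot_iff _).1 hL
  have hx' : Matrix.vecMul x M = 0 ∧ ∑ i, x i = 0 := by
    simpa [L, Prod.ext_iff] using hx
  obtain ⟨hxM, hxs⟩ := hx'
  have hxD : ∀ j, ∑ a, x a * D a j = 0 := by
    intro j
    have : Matrix.vecMul x D = 0 := by
      rw [hfact, ← Matrix.vecMul_vecMul, hxM, Matrix.zero_vecMul]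
    exact congrFun this j
  have hsum : ∀ j, (∑ a, x a * k a) - x j * p j + (if j = c then ∑ a, x a * q a else 0) = 0 := by
    intro j
    have h : ∑ a, x a * (D a j - D c j) = 0 := by
      simp only [mul_sub, Finset.sum_sub_distrib, ← Finset.sum_mul, hxD, hxs]
      simp
    simp only [hD] at h
    refine Eq.trans ?_ h
    simp only [mul_add, mul_sub, Finset.sum_add_distrib, Finset.sum_sub_distrib]
    by_cases hj : j = c <;> simp [hj]
  set K := ∑ a, x a * k a with hK
  have ha : ∀ a, a ≠ c → x a * p a = K := by
    intro a h
    have := hsum a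
    rw [if_neg h] at this
    linarith
  have hcK : K + ∑ a, x a * q a = 0 := by
    have := hsum c
    rw [if_pos rfl, (hzero c rfl).1] at this
    linarith
  have hK0 : K = 0 := by
    have hterm : 0 ≤ ∑ a, K * (x a * q a) := by
      refine Finset.sum_nonneg fun a _ => ?_
      by_cases h : a = c
      · rw [(hzero a h).2]; simp
      · obtain ⟨hp, hq⟩ := hpos a h
        rw [← ha a h]
        have : x a * p a * (x a * q a) = x a ^ 2 * (p a * q a) := by ring
        rw [this]; positivity
    rw [← Finset.mul_sum] at hterm
    have : ∑ a, x a * q a = -K := by linarith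
    rw [this] at hterm
    nlinarith [sq_nonneg K]
  have hxa : ∀ a, a ≠ c → x a = 0 := by
    intro a h
    have h5 := ha a h
    rw [hK0] at h5
    exact (mul_eq_zero.1 h5).resolve_right (hpos a h).1.ne'
  apply hx0
  funext a
  by_cases h : a = c
  · rw [Finset.sum_eq_single c (fun b _ hb => hxa b hb) (by simp)] at hxs
    rw [h]; exact hxs
  · exact hxa a h
end

section
/- Let v ≥ 3, let B, D ∈ ℝ^{v×v} with entries b_{i,j} and d_{i,j}, and let f be the constant-attention model defined by B and D. Suppose there exists C > 0 such that f has precision C at length 1 and precision C at length 2. Then for every pair of distinct tokens t, u ∈ V, the difference d_{t,w} − d_{u,w} is independent of w on V \ {t,u}; that is, for all w, w' ∈ V \ {t,u} one has d_{t,w} − d_{u,w} = d_{t,w'} − d_{u,w'}. -/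
/-- If the constant-attention model defined by `B` and `D` has precision `C > 0`
at lengths 1 and 2, then for distinct tokens `t, u`, the difference
`d_{t,w} − d_{u,w}` is independent of `w` on `V \ {t, u}`. -/
theorem displacement_difference_constant (v : ℕ) (hv : 3 ≤ v)
    (B D : Matrix (Fin v) (Fin v) ℝ) (C : ℝ) (hC : 0 < C)
    (h1 : hasPrec B D C 1) (h2 : hasPrec B D C 2) :
    ∀ t u : Fin v, t ≠ u → ∀ w w' : Fin v, w ≠ t → w ≠ u → w' ≠ t → w' ≠ u →
      D t w - D u w = D t w' - D u w' := by
  intro t u htu w w' hwt hwu hwt' hwu'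
  have a := (h1 0 rfl ![u] (fun i j _ => by omega) w
    (by simpa using hwu) w').2 (by simpa using hwu')
  have inj : Function.Injective ![t, u] := by
    intro i j h
    fin_cases i <;> fin_cases j <;> simp_all
  have b := (h2 1 rfl ![t, u] inj w (by simp [hwt, hwu]) w').2
    (by simp [hwt', hwu'])
  simp [cam, Fin.sum_univ_two, Fin.last] at a b
  linarith
end

section
/- Let v ≥ 2 and C > 0. Define matrices B, D ∈ ℝ^{v×v} by: b_{t,u} = −1 if t = u ≤ v−1, b_{v,u} = 1 for u ≤ v−1, b_{t,u} = 0 otherwise; and d_{t,u} = −vC if t = u ≤ v−1, d_{v,u} = vC for u ≤ v−1, d_{t,u} = 0 otherwise (in particular the v-th columns of B and D are zero). Then the constant-attention model f defined by B and D has precision C at length s for every integer 1 ≤ s < v. -/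
/-- The hardcoded bias matrix: `b_{t,u} = −1` if `t = u` is not the last token,
`b_{v,u} = 1` for `u` not the last token, and `0` otherwise. -/
noncomputable def Bhard (v : ℕ) : Matrix (Fin v) (Fin v) ℝ :=
  Matrix.of fun i j =>
    if i = j ∧ (i : ℕ) < v - 1 then (-1 : ℝ)
    else if (i : ℕ) = v - 1 ∧ (j : ℕ) < v - 1 then 1 else 0

/-- The hardcoded displacement matrix: `d_{t,u} = −vC` if `t = u` is not the last
token, `d_{v,u} = vC` for `u` not the last token, and `0` otherwise. -/
noncomputable def Dhard (v : ℕ) (C : ℝ) : Matrix (Fin v) (Fin v) ℝ :=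
  Matrix.of fun i j =>
    if i = j ∧ (i : ℕ) < v - 1 then -((v : ℝ) * C)
    else if (i : ℕ) = v - 1 ∧ (j : ℕ) < v - 1 then (v : ℝ) * C else 0

lemma Bhard_eq (v : ℕ) (i j : Fin v) :
    Bhard v i j = (if (i : ℕ) = v - 1 then (1 : ℝ) else 0) - if i = j then 1 else 0 := by
  have hi := i.isLt
  have hj := j.isLt
  simp only [Bhard, Matrix.of_apply, Fin.ext_iff]
  split_ifs <;> first | (exfalso; omega) | norm_num

lemma Dhard_eq (v : ℕ) (C : ℝ) (i j : Fin v) :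
    Dhard v C i j = (if (i : ℕ) = v - 1 then (v : ℝ) * C else 0)
      - if i = j then (v : ℝ) * C else 0 := by
  have hi := i.isLt
  have hj := j.isLt
  simp only [Dhard, Matrix.of_apply, Fin.ext_iff]
  split_ifs <;> first | (exfalso; omega) | simp

lemma cam_diff (v : ℕ) (C : ℝ) (n : ℕ) (t : Fin (n + 1) → Fin v) (u w : Fin v)
    (hu : u ∉ Set.range t) :
    cam (Bhard v) (Dhard v C) t u - cam (Bhard v) (Dhard v C) t w =
      (if t (Fin.last n) = w then (1 : ℝ) else 0)
        + ((n + 1 : ℕ) : ℝ)⁻¹ * ∑ i, if t i = w then (v : ℝ) * C else 0 := by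
  have h : ∀ i, t i ≠ u := fun i hi => hu ⟨i, hi⟩
  simp only [cam, Bhard_eq, Dhard_eq, Finset.sum_sub_distrib, h, if_false,
    Finset.sum_const_zero]
  ring

/-- The hardcoded constant-attention model defined by `Bhard` and `Dhard` has
precision `C` at every length `1 ≤ s < v`. -/
theorem hardcoded_model_precise (v : ℕ) (hv : 2 ≤ v) (C : ℝ) (hC : 0 < C) :
    ∀ s : ℕ, 1 ≤ s → s < v → hasPrec (Bhard v) (Dhard v C) C s := by
  intro s hs hsv n hn t ht u hu w
  rw [cam_diff v C n t u w hu]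
  constructor
  · rintro ⟨k, rfl⟩
    have h1 : ∑ i, (if t i = t k then (v : ℝ) * C else 0) = v * C := by
      simp [ht.eq_iff]
    rw [h1]
    have h2 : (0 : ℝ) ≤ if t (Fin.last n) = t k then (1 : ℝ) else 0 := by
      split_ifs <;> norm_num
    have h3 : ((n + 1 : ℕ) : ℝ) < v := by
      exact_mod_cast hn ▸ hsv
    have h4 : (0 : ℝ) < ((n + 1 : ℕ) : ℝ) := by positivity
    have h5 : C < ((n + 1 : ℕ) : ℝ)⁻¹ * (v * C) := by
      rw [lt_inv_mul_iff₀ h4]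
      exact mul_lt_mul_of_pos_right h3 hC
    linarith
  · intro hw
    have h : ∀ i, t i ≠ w := fun i hi => hw ⟨i, hi⟩
    simp [h]
end

section
/- Let v ≥ 2 and C > 0. There exist matrices B, D ∈ ℝ^{v×v}, each of rank exactly v − 1, such that the constant-attention model f defined by B and D has precision C at length s for every integer 1 ≤ s < v. Consequently, the lower bounds rank(B + D) ≥ v − 1 and rank(D) ≥ v − 1 required for precision at lengths 1 and 2 are tight. -/
def camMat (v : ℕ) (c : ℝ) : Matrix (Fin v) (Fin v) ℝ :=
  Matrix.of fun i j => c - if i = j then c * v else 0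

theorem camMat_rank (v : ℕ) (hv : 2 ≤ v) (c : ℝ) (hc : c ≠ 0) :
    (camMat v c).rank = v - 1 := by
  have hv0 : (v : ℝ) ≠ 0 := by positivity
  have hmul : ∀ x : Fin v → ℝ, ∀ i, (camMat v c).mulVecLin x i = c * (∑ j, x j) - c * v * x i := by
    intro x i
    simp [camMat, Matrix.mulVec, dotProduct, sub_mul, Finset.sum_sub_distrib, Finset.mul_sum]
  have hone : (fun _ => 1 : Fin v → ℝ) ∈ LinearMap.ker (camMat v c).mulVecLin := by
    rw [LinearMap.mem_ker]
    ext i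
    rw [hmul]
    simp
  have hker : Module.finrank ℝ (LinearMap.ker (camMat v c).mulVecLin) = 1 := by
    apply (finrank_eq_one_iff_of_nonzero' ⟨_, hone⟩ ?_).2
    · rintro ⟨x, hx⟩
      refine ⟨(∑ j, x j) / v, ?_⟩
      apply Subtype.ext
      ext i
      rw [LinearMap.mem_ker] at hx
      have h := hmul x i
      rw [hx] at h
      simp only [Pi.zero_apply] at h
      have h2 : c * ((∑ j, x j) - v * x i) = 0 := by linarith
      have h3 := (mul_eq_zero.1 h2).resolve_left hc
      simp only [SetLike.mk_smul_mk, Pi.smul_apply, smul_eq_mul, mul_one]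
      rw [div_eq_iff hv0]
      linarith
    · intro h
      have := congrFun (congrArg Subtype.val h) ⟨0, by omega⟩
      simp at this
  have := LinearMap.finrank_range_add_finrank_ker (camMat v c).mulVecLin
  rw [hker, Module.finrank_fin_fun] at this
  unfold Matrix.rank
  omega

theorem camMat_sum (v : ℕ) (c : ℝ) {n : ℕ} (t : Fin (n + 1) → Fin v)
    (ht : Function.Injective t) (w : Fin v) :
    (w ∈ Set.range t → ∑ i, camMat v c (t i) w = (n + 1) * c - c * v) ∧
    (w ∉ Set.range t → ∑ i, camMat v c (t i) w = (n + 1) * c) := by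
  constructor
  · rintro ⟨k, rfl⟩
    simp [camMat, Finset.sum_sub_distrib, ht.eq_iff]
  · intro h
    have h' : ∀ i, t i ≠ w := fun i hi => h ⟨i, hi⟩
    simp [camMat, h']

/-- For every `v ≥ 2` and `C > 0` there exist matrices `B, D ∈ ℝ^{v×v}`, each of
rank exactly `v − 1`, such that the constant-attention model they define has
precision `C` at every length `1 ≤ s < v`; in particular the lower bounds
`rank(B + D) ≥ v − 1` and `rank D ≥ v − 1` are tight. -/
theorem rank_bounds_tight (v : ℕ) (hv : 2 ≤ v) (C : ℝ) (hC : 0 < C) :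
    ∃ B D : Matrix (Fin v) (Fin v) ℝ,
      B.rank = v - 1 ∧ D.rank = v - 1 ∧ (B + D).rank = v - 1 ∧
      ∀ s : ℕ, 1 ≤ s → s < v → hasPrec B D C s := by
  refine ⟨camMat v C, camMat v C, camMat_rank v hv C hC.ne', camMat_rank v hv C hC.ne', ?_, ?_⟩
  · have : camMat v C + camMat v C = camMat v (2 * C) := by
      ext i j
      simp only [camMat, Matrix.add_apply, Matrix.of_apply]
      split_ifs <;> ring
    rw [this]
    exact camMat_rank v hv _ (by positivity)
  · intro s hs hsv n hn t ht u hu w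
    have hn1 : (0 : ℝ) < n + 1 := by positivity
    have hnv : (n + 1 : ℝ) < v := by
      have : n + 1 < v := by omega
      exact_mod_cast this
    have hul : t (Fin.last n) ≠ u := fun h => hu ⟨_, h⟩
    have hBu : camMat v C (t (Fin.last n)) u = C := by simp [camMat, hul]
    constructor
    · intro hw
      have hBw : camMat v C (t (Fin.last n)) w ≤ C := by
        simp only [camMat, Matrix.of_apply]
        split_ifs
        · have : 0 ≤ C * v := by positivity
          linarith
        · simp
      simp only [cam]
      rw [(camMat_sum v C t ht u).2 hu, (camMat_sum v C t ht w).1 hw, hBu]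
      have h1 : ((n + 1 : ℕ) : ℝ)⁻¹ * ((n + 1) * C) -
          ((n + 1 : ℕ) : ℝ)⁻¹ * ((n + 1) * C - C * v) = C * v / (n + 1) := by
        push_cast
        ring
      have h2 : C < C * v / (n + 1) := by
        rw [lt_div_iff₀ hn1]
        exact mul_lt_mul_of_pos_left hnv hC
      linarith
    · intro hw
      have hwl : t (Fin.last n) ≠ w := fun h => hw ⟨_, h⟩
      have hBw : camMat v C (t (Fin.last n)) w = C := by simp [camMat, hwl]
      simp only [cam]
      rw [(camMat_sum v C t ht u).2 hu, (camMat_sum v C t ht w).2 hw, hBu, hBw, sub_self]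
end
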